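/- arXiv:1405.3132 — 5 statements merged into one kernel-verified Lean document; each statement's English description precedes it below -/
import Mathlib

section
/- Let G be an abelian group, A a finite nonempty subset of G, D = A − A and S = A + A. Then (Σ_{x∈D} |D ∩ (D − x)|³)⁴ ≥ |D|¹², (Σ_{x∈D} |D ∩ (D − x)|³)⁴ · E(A)⁹ · |D|² ≥ |A|⁴⁵, (Σ_{x∈D} |S ∩ (S − x)|³)⁴ ≥ |S|¹², and (Σ_{x∈D} |S ∩ (S − x)|³)⁴ · E(A)⁹ · |D|² ≥ |A|⁴⁵. -/
open Finset Pointwise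

variable {G : Type*} [AddCommGroup G] [DecidableEq G]

/-- `A_s = A ∩ (A - s) = {x ∈ A : x + s ∈ A}`. -/
def stab (A : Finset G) (s : G) : Finset G := A ∩ A.image (fun a => a - s)

/-- `E_k(A) = ∑_{s ∈ G} |A_s|^k` (the summand vanishes off `A - A`). -/
def energyK (k : ℕ) (A : Finset G) : ℕ := ∑ s ∈ A - A, (stab A s).card ^ k

/-- The additive energy `E(A)`. -/
def energy (A : Finset G) : ℕ := energyK 2 A

lemma mem_stab (A : Finset G) (x y : G) : y ∈ stab A x ↔ y ∈ A ∧ y + x ∈ A := by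
  unfold stab
  simp only [Finset.mem_inter, Finset.mem_image]
  constructor
  · rintro ⟨h, a, ha, rfl⟩
    exact ⟨h, by simpa using ha⟩
  · rintro ⟨h, h'⟩
    exact ⟨h, y + x, h', by simp⟩

lemma shift_sum (A : Finset G) (b : G) (hb : b ∈ A) (k : G → ℝ) (hk : ∀ y, y ∉ A → k y = 0) :
    ∑ x ∈ A - A, k (b + x) = ∑ y ∈ A, k y := by
  have h1 : ∑ y ∈ (A - A).image (fun x => b + x), k y = ∑ x ∈ A - A, k (b + x) :=
    Finset.sum_image (by intro x _ y _ h; simpa using h)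
  rw [← h1]
  symm
  apply Finset.sum_subset
  · intro y hy
    rw [Finset.mem_image]
    exact ⟨y - b, Finset.sub_mem_sub hy hb, by abel⟩
  · intro y _ hy
    exact hk y hy

/-- Cauchy-Schwarz over the fibres of `z`. -/
lemma cs_fibre {ι : Type*} (P : Finset ι) (Z : Finset G) (w : ι → ℝ) (z : ι → G)
    (hw : ∀ p, 0 ≤ w p) (hz : ∀ p ∈ P, w p ≠ 0 → z p ∈ Z) :
    (∑ p ∈ P, w p) ^ 2 ≤
      (Z.card : ℝ) * ∑ p ∈ P, ∑ q ∈ P, if z p = z q then w p * w q else 0 := by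
  have h1 : ∑ p ∈ P, w p = ∑ t ∈ Z, ∑ p ∈ P, if z p = t then w p else 0 := by
    rw [Finset.sum_comm]
    apply Finset.sum_congr rfl
    intro p hp
    rw [Finset.sum_ite_eq]
    split_ifs with h
    · rfl
    · by_contra h'
      exact h (hz p hp h')
  rw [h1]
  refine (sq_sum_le_card_mul_sum_sq).trans ?_
  apply mul_le_mul_of_nonneg_left _ (Nat.cast_nonneg _)
  have h2 : ∀ t ∈ Z, (∑ p ∈ P, if z p = t then w p else 0) ^ 2 =
      ∑ p ∈ P, ∑ q ∈ P, if z p = t then (if z p = z q then w p * w q else 0) else 0 := by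
    intro t _
    rw [sq, Finset.sum_mul_sum]
    apply Finset.sum_congr rfl; intro p _
    apply Finset.sum_congr rfl; intro q _
    by_cases h : z p = t
    · by_cases h' : z q = t
      · simp [h, h']
      · simp [h, h', Ne.symm h']
    · simp [h]
  rw [Finset.sum_congr rfl h2, Finset.sum_comm]
  apply Finset.sum_le_sum; intro p _
  rw [Finset.sum_comm]
  apply Finset.sum_le_sum; intro q _
  rw [Finset.sum_ite_eq]
  have := mul_nonneg (hw p) (hw q)
  split_ifs <;> simp [this]

/-- Weighted energy. -/
def wQ (A : Finset G) (g f : G → ℝ) : ℝ :=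
  ∑ b ∈ A, ∑ b' ∈ A, ∑ a ∈ A, ∑ a' ∈ A,
    if a - a' = b - b' then g a * g a' * (f b * f b') else 0

lemma cs_wQ (A Z : Finset G) (g f : G → ℝ) (op : G → G → G)
    (hop : (∀ a b a' b', op a b = op a' b' ↔ a - a' = b - b') ∨
      (∀ a b a' b', op a b = op a' b' ↔ a - a' = b' - b))
    (hg : ∀ a, 0 ≤ g a) (hf : ∀ a, 0 ≤ f a)
    (hz : ∀ a ∈ A, ∀ b ∈ A, f b ≠ 0 → op a b ∈ Z) :
    ((∑ a ∈ A, g a) * ∑ b ∈ A, f b) ^ 2 ≤ (Z.card : ℝ) * wQ A g f := by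
  have h := cs_fibre (A ×ˢ A) Z (fun p => g p.2 * f p.1) (fun p => op p.2 p.1)
    (fun p => mul_nonneg (hg _) (hf _)) (by
      intro p hp hne
      rw [Finset.mem_product] at hp
      exact hz _ hp.2 _ hp.1 (right_ne_zero_of_mul hne))
  simp only [Finset.sum_product] at h
  have e1 : (∑ a ∈ A, g a) * ∑ b ∈ A, f b = ∑ x ∈ A, ∑ y ∈ A, g y * f x := by
    rw [Finset.sum_mul_sum, Finset.sum_comm]
  rw [e1]
  refine h.trans (le_of_eq ?_)
  congr 1
  unfold wQ
  rcases hop with hop | hop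
  · apply Finset.sum_congr rfl; intro b _
    rw [Finset.sum_comm]
    apply Finset.sum_congr rfl; intro b' _
    apply Finset.sum_congr rfl; intro a _
    apply Finset.sum_congr rfl; intro a' _
    simp only [hop]
    split_ifs
    · ring
    · rfl
  · rw [Finset.sum_comm' (t' := A) (s' := fun _ => A) (by simp [and_comm])]
    conv_rhs => rw [Finset.sum_comm]
    rw [Finset.sum_comm' (t' := A) (s' := fun _ => A) (by simp [and_comm])]
    apply Finset.sum_congr rfl; intro b _
    rw [Finset.sum_comm]
    apply Finset.sum_congr rfl; intro b' _
    apply Finset.sum_congr rfl; intro a _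
    apply Finset.sum_congr rfl; intro a' _
    simp only [hop]
    split_ifs
    · ring
    · rfl

/-- Contribution of `b` to the energy. -/
def eb (A : Finset G) (b : G) : ℝ :=
  ∑ b' ∈ A, ∑ a ∈ A, ∑ a' ∈ A, if a - a' = b - b' then 1 else 0

noncomputable def ph (A : Finset G) (y : G) : ℝ := if y ∈ A then 1 / √(eb A y) else 0

noncomputable def cc (A : Finset G) (x : G) : ℝ := ∑ b ∈ A, ph A b * ph A (b + x)

lemma nn (A : Finset G) (w : G) :
    0 ≤ ∑ a ∈ A, ∑ a' ∈ A, (if a - a' = w then (1 : ℝ) else 0) :=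
  Finset.sum_nonneg fun _ _ => Finset.sum_nonneg fun _ _ => by split_ifs <;> simp

lemma eb_pos (A : Finset G) (b : G) (hb : b ∈ A) : 0 < eb A b := by
  unfold eb
  apply Finset.sum_pos' (fun b' _ => nn A _)
  refine ⟨b, hb, ?_⟩
  apply Finset.sum_pos' (fun a _ => Finset.sum_nonneg fun _ _ => by split_ifs <;> simp)
  refine ⟨b, hb, ?_⟩
  apply Finset.sum_pos' (fun a _ => by split_ifs <;> simp)
  exact ⟨b, hb, by simp⟩

lemma ph_nonneg (A : Finset G) (y : G) : 0 ≤ ph A y := by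
  unfold ph
  split_ifs
  · positivity
  · rfl

lemma ph_zero (A : Finset G) (y : G) (h : y ∉ A) : ph A y = 0 := by simp [ph, h]

lemma ph_sq (A : Finset G) (y : G) (h : y ∈ A) : ph A y ^ 2 * eb A y = 1 := by
  have := eb_pos A y h
  simp only [ph, h, if_true]
  rw [div_pow, Real.sq_sqrt this.le]
  field_simp

lemma cc_nonneg (A : Finset G) (x : G) : 0 ≤ cc A x :=
  Finset.sum_nonneg fun _ _ => mul_nonneg (ph_nonneg _ _) (ph_nonneg _ _)

lemma sum_cc (A : Finset G) (ψ : G → ℝ) :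
    ∑ b' ∈ A, ∑ b ∈ A, ph A b * ph A b' * ψ (b - b') = ∑ x ∈ A - A, ψ x * cc A x := by
  unfold cc
  simp only [Finset.mul_sum]
  rw [Finset.sum_comm (s := A - A)]
  apply Finset.sum_congr rfl; intro b' hb'
  have := shift_sum A b' hb' (fun y => ph A y * ph A b' * ψ (y - b'))
    (by intro y hy; simp [ph_zero A y hy])
  rw [← this]
  apply Finset.sum_congr rfl; intro x _
  simp only [add_sub_cancel_left]
  ring

lemma cc_eq (A : Finset G) (w : G) :
    ∑ a ∈ A, ∑ a' ∈ A, (if a - a' = w then ph A a * ph A a' else 0) = cc A w := by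
  rw [Finset.sum_comm]
  unfold cc
  apply Finset.sum_congr rfl; intro a' _
  have : ∀ a ∈ A, (if a - a' = w then ph A a * ph A a' else 0) =
      if a' + w = a then ph A a' * ph A a else 0 := by
    intro a _
    have : a - a' = w ↔ a' + w = a := by
      rw [sub_eq_iff_eq_add, add_comm w, eq_comm]
    simp only [this, mul_comm]
  rw [Finset.sum_congr rfl this, Finset.sum_ite_eq]
  split_ifs with h
  · rfl
  · simp [ph_zero A _ h]

noncomputable def FF (A : Finset G) (x : G) : ℝ := wQ A (ph A) (fun b => ph A b * ph A (b + x))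

lemma sum_FF (A : Finset G) : ∑ x ∈ A - A, FF A x = ∑ x ∈ A - A, cc A x ^ 3 := by
  have h1 : ∀ x, FF A x = ∑ b' ∈ A, ∑ b ∈ A,
      ph A b * ph A b' * cc A (b - b') * (ph A (b' + x) * ph A (b' + x + (b - b'))) := by
    intro x
    unfold FF wQ
    rw [Finset.sum_comm]
    apply Finset.sum_congr rfl; intro b' _
    apply Finset.sum_congr rfl; intro b _
    rw [← cc_eq, Finset.mul_sum, Finset.sum_mul]
    apply Finset.sum_congr rfl; intro a _
    rw [Finset.mul_sum, Finset.sum_mul]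
    apply Finset.sum_congr rfl; intro a' _
    have : b' + x + (b - b') = b + x := by abel
    rw [this]
    split_ifs
    · ring
    · simp
  have h3 := sum_cc A (fun w => cc A w ^ 2)
  have h4 : ∑ x ∈ A - A, cc A x ^ 3 = ∑ x ∈ A - A, cc A x ^ 2 * cc A x :=
    Finset.sum_congr rfl fun x _ => by ring
  rw [h4, ← h3, Finset.sum_congr rfl (fun x _ => h1 x), Finset.sum_comm]
  apply Finset.sum_congr rfl; intro b' hb'
  rw [Finset.sum_comm]
  apply Finset.sum_congr rfl; intro b hb
  rw [← Finset.mul_sum,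
    shift_sum A b' hb' (fun y => ph A y * ph A (y + (b - b')))
      (by intro y hy; simp [ph_zero A y hy])]
  change _ * cc A (b - b') = _
  ring

lemma wQ_one (A : Finset G) (x : G) :
    wQ A (fun _ => 1) (fun b => ph A b * ph A (b + x)) ≤ cc A x := by
  set f : G → ℝ := fun b => ph A b * ph A (b + x) with hf
  have hf0 : ∀ b, 0 ≤ f b := fun b => mul_nonneg (ph_nonneg _ _) (ph_nonneg _ _)
  set N : G → ℝ := fun w => ∑ a ∈ A, ∑ a' ∈ A, if a - a' = w then 1 else 0 with hN
  have hN0 : ∀ w, 0 ≤ N w := nn A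
  have hNs : ∀ w, N (-w) = N w := by
    intro w
    simp only [hN]
    rw [Finset.sum_comm]
    apply Finset.sum_congr rfl; intro a _
    apply Finset.sum_congr rfl; intro a' _
    have : a' - a = -w ↔ a - a' = w := by
      rw [← neg_sub a a', neg_inj]
    simp only [this]
  have h1 : wQ A (fun _ => 1) f = ∑ b ∈ A, ∑ b' ∈ A, f b * f b' * N (b - b') := by
    unfold wQ
    apply Finset.sum_congr rfl; intro b _
    apply Finset.sum_congr rfl; intro b' _
    simp only [hN, Finset.mul_sum]
    apply Finset.sum_congr rfl; intro a _
    apply Finset.sum_congr rfl; intro a' _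
    split_ifs <;> simp
  -- the restricted sum
  set J : G → ℝ := fun b => if b + x ∈ A then 1 else 0 with hJ
  have hfJ : ∀ b, f b * J b = f b := by
    intro b
    simp only [hf, hJ]
    split_ifs with h
    · simp
    · simp [ph_zero A _ h]
  have hJ0 : ∀ b, 0 ≤ J b := by
    intro b; simp only [hJ]; split_ifs <;> simp
  have hJ1 : ∀ b, J b ≤ 1 := by
    intro b; simp only [hJ]; split_ifs <;> simp
  have hswap : ∑ b ∈ A, ∑ b' ∈ A, f b' ^ 2 * J b * N (b - b') =
      ∑ b ∈ A, ∑ b' ∈ A, f b ^ 2 * J b' * N (b - b') := by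
    rw [Finset.sum_comm]
    apply Finset.sum_congr rfl; intro b _
    apply Finset.sum_congr rfl; intro b' _
    rw [← hNs (b - b'), neg_sub]
  have h2 : ∑ b ∈ A, ∑ b' ∈ A, f b * f b' * N (b - b') ≤
      ∑ b ∈ A, ∑ b' ∈ A, f b ^ 2 * J b' * N (b - b') := by
    have : ∑ b ∈ A, ∑ b' ∈ A, f b * f b' * N (b - b') ≤
        ∑ b ∈ A, ∑ b' ∈ A, ((1/2) * (f b ^ 2 * J b' * N (b - b')) +
          (1/2) * (f b' ^ 2 * J b * N (b - b'))) := by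
      apply Finset.sum_le_sum; intro b _
      apply Finset.sum_le_sum; intro b' _
      have e1 : f b * f b' ≤ (1/2) * (f b ^ 2 * J b') + (1/2) * (f b' ^ 2 * J b) := by
        by_cases hb : b + x ∈ A
        · by_cases hb' : b' + x ∈ A
          · simp only [hJ, hb, hb', if_true]
            nlinarith [sq_nonneg (f b - f b')]
          · have : f b' = 0 := by simp [hf, ph_zero A _ hb']
            rw [this]; simp only [mul_zero]
            have := hJ0 b'; have := hJ0 b
            positivity
        · have : f b = 0 := by simp [hf, ph_zero A _ hb]
          rw [this]; simp only [zero_mul]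
          have := hJ0 b'; have := hJ0 b
          positivity
      calc _ ≤ ((1/2) * (f b ^ 2 * J b') + (1/2) * (f b' ^ 2 * J b)) * N (b - b') :=
            mul_le_mul_of_nonneg_right e1 (hN0 _)
        _ = _ := by ring
    refine this.trans (le_of_eq ?_)
    simp only [Finset.sum_add_distrib, ← Finset.mul_sum]
    rw [hswap]
    ring
  rw [h1]
  refine h2.trans ?_
  change _ ≤ ∑ b ∈ A, f b
  apply Finset.sum_le_sum; intro b hb
  set e := ∑ b' ∈ A, J b' * N (b - b') with he
  have e0 : 0 ≤ e := Finset.sum_nonneg fun b' _ => mul_nonneg (hJ0 _) (hN0 _)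
  have e1 : ∑ b' ∈ A, f b ^ 2 * J b' * N (b - b') = f b * (f b * e) := by
    rw [he, Finset.mul_sum, Finset.mul_sum]
    apply Finset.sum_congr rfl; intro b' _
    ring
  rw [e1]
  suffices f b * e ≤ 1 by nlinarith [hf0 b]
  by_cases hbx : b + x ∈ A
  · have l1 : e ≤ eb A b := by
      unfold eb
      apply Finset.sum_le_sum; intro b' _
      change _ ≤ N (b - b')
      nlinarith [hJ1 b', hN0 (b - b')]
    have l2 : e ≤ eb A (b + x) := by
      have m1 : e = ∑ b' ∈ stab A x, N (b - b') := by
        rw [he]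
        have : stab A x = A.filter (fun b' => b' + x ∈ A) := by
          ext y; rw [mem_stab, Finset.mem_filter]
        rw [this, Finset.sum_filter]
        apply Finset.sum_congr rfl; intro b' _
        simp only [hJ]
        split_ifs <;> simp
      have m2 : ∑ b' ∈ stab A x, N (b - b') =
          ∑ y ∈ (stab A x).image (fun y => y + x), N (b + x - y) := by
        rw [Finset.sum_image (by intro u _ v _ h; simpa using h)]
        apply Finset.sum_congr rfl; intro b' _
        congr 1; abel
      rw [m1, m2]
      unfold eb
      change _ ≤ ∑ y ∈ A, N (b + x - y)
      apply Finset.sum_le_sum_of_subset_of_nonneg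
      · intro y hy
        obtain ⟨u, hu, rfl⟩ := Finset.mem_image.1 hy
        exact ((mem_stab A x u).1 hu).2
      · intro y _ _; exact hN0 _
    have p1 := ph_sq A b hb
    have p2 := ph_sq A (b + x) hbx
    have : (f b * e) ^ 2 ≤ 1 := by
      calc (f b * e) ^ 2 = (ph A b ^ 2 * e) * (ph A (b + x) ^ 2 * e) := by
            simp only [hf]; ring
        _ ≤ (ph A b ^ 2 * eb A b) * (ph A (b + x) ^ 2 * eb A (b + x)) := by
            have := eb_pos A b hb
            gcongr
        _ = 1 := by rw [p1, p2]; ring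
    nlinarith [mul_nonneg (hf0 b) e0]
  · have : f b = 0 := by simp [hf, ph_zero A _ hbx]
    rw [this]; simp

lemma stab_card_eq (A : Finset G) (w : G) :
    ((stab A w).card : ℝ) = ∑ a ∈ A, ∑ a' ∈ A, if a - a' = w then 1 else 0 := by
  have : stab A w = A.filter (fun b' => b' + w ∈ A) := by
    ext y; rw [mem_stab, Finset.mem_filter]
  rw [this, Finset.card_filter, Finset.sum_comm]
  push_cast
  apply Finset.sum_congr rfl; intro a' _
  have : ∀ a ∈ A, (if a - a' = w then (1:ℝ) else 0) = if a' + w = a then 1 else 0 := by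
    intro a _
    have : a - a' = w ↔ a' + w = a := by
      rw [sub_eq_iff_eq_add, add_comm w, eq_comm]
    simp only [this]
  rw [Finset.sum_congr rfl this, Finset.sum_ite_eq]

lemma sum_eb (A : Finset G) : ∑ b ∈ A, eb A b = (energy A : ℝ) := by
  unfold eb energy energyK
  push_cast
  simp only [← stab_card_eq]
  have : ∀ s ∈ A - A, ((stab A s).card : ℝ) ^ 2 =
      ∑ b ∈ A, ∑ b' ∈ A, if b - b' = s then ((stab A s).card : ℝ) else 0 := by
    intro s _
    rw [sq]
    nth_rewrite 1 [stab_card_eq]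
    rw [Finset.sum_mul]
    apply Finset.sum_congr rfl; intro b _
    rw [Finset.sum_mul]
    apply Finset.sum_congr rfl; intro b' _
    split_ifs <;> simp
  rw [Finset.sum_congr rfl this, Finset.sum_comm (s := A - A)]
  apply Finset.sum_congr rfl; intro b hb
  rw [Finset.sum_comm (s := A - A)]
  apply Finset.sum_congr rfl; intro b' hb'
  rw [Finset.sum_ite_eq, if_pos (Finset.sub_mem_sub hb hb')]

lemma Phi_bound (A : Finset G) :
    (A.card : ℝ) ^ 3 ≤ (∑ a ∈ A, ph A a) ^ 2 * energy A := by
  set Φ := ∑ a ∈ A, ph A a with hΦ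
  have hΦ0 : 0 ≤ Φ := Finset.sum_nonneg fun _ _ => ph_nonneg _ _
  set Ψ := ∑ a ∈ A, √(eb A a) with hΨ
  have hΨ0 : 0 ≤ Ψ := Finset.sum_nonneg fun _ _ => Real.sqrt_nonneg _
  have h1 : (A.card : ℝ) ^ 2 ≤ Φ * Ψ := by
    have := Finset.sum_sq_le_sum_mul_sum_of_sq_eq_mul A (r := fun _ => (1:ℝ))
      (f := ph A) (g := fun a => √(eb A a)) (fun _ _ => ph_nonneg _ _)
      (fun _ _ => Real.sqrt_nonneg _) (by
        intro a ha
        have := Real.sqrt_pos.2 (eb_pos A a ha)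
        simp only [ph, ha, if_true]
        field_simp)
    simpa using this
  have h2 : Ψ ^ 2 ≤ A.card * energy A := by
    rw [← sum_eb]
    refine (sq_sum_le_card_mul_sum_sq).trans (le_of_eq ?_)
    congr 1
    apply Finset.sum_congr rfl; intro a ha
    exact Real.sq_sqrt (eb_pos A a ha).le
  rcases Nat.eq_zero_or_pos A.card with h0 | h0
  · have hE : (0:ℝ) ≤ Φ ^ 2 * energy A := mul_nonneg (sq_nonneg _) (Nat.cast_nonneg _)
    rw [h0]; simpa using hE
  have hn : (0:ℝ) < A.card := by exact_mod_cast h0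
  have h3 : (A.card : ℝ) ^ 4 ≤ Φ ^ 2 * (A.card * energy A) := by
    calc (A.card : ℝ) ^ 4 = ((A.card : ℝ) ^ 2) ^ 2 := by ring
      _ ≤ (Φ * Ψ) ^ 2 := by gcongr
      _ = Φ ^ 2 * Ψ ^ 2 := by ring
      _ ≤ _ := by gcongr
  have h4 : (A.card : ℝ) * (A.card : ℝ) ^ 3 ≤ A.card * (Φ ^ 2 * energy A) := by
    calc _ = (A.card : ℝ) ^ 4 := by ring
      _ ≤ _ := h3
      _ = _ := by ring
  exact le_of_mul_le_mul_left h4 hn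

lemma final_arith (n Φ d T C S E : ℝ) (hn0 : 0 ≤ n) (hΦ0 : 0 ≤ Φ) (hT0 : 0 ≤ T)
    (hC0 : 0 ≤ C) (hS0 : 0 ≤ S) (hE0 : 0 ≤ E) (k5 : n ^ 6 * C ≤ T)
    (k6 : (Φ ^ 3) ^ 2 ≤ S * C) (k7 : S ^ 3 ≤ d ^ 2 * T) (this : n ^ 3 ≤ Φ ^ 2 * E) :
    n ^ 45 ≤ T ^ 4 * E ^ 9 * d ^ 2 := by
  have k8 : Φ ^ 18 ≤ d ^ 2 * T * C ^ 3 := by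
    calc Φ ^ 18 = ((Φ ^ 3) ^ 2) ^ 3 := by ring
      _ ≤ (S * C) ^ 3 := by gcongr
      _ = S ^ 3 * C ^ 3 := by ring
      _ ≤ _ := by gcongr
  have k9 : n ^ 18 * Φ ^ 18 ≤ d ^ 2 * T ^ 4 := by
    calc n ^ 18 * Φ ^ 18 ≤ n ^ 18 * (d ^ 2 * T * C ^ 3) := by gcongr
      _ = d ^ 2 * T * (n ^ 6 * C) ^ 3 := by ring
      _ ≤ d ^ 2 * T * T ^ 3 := by gcongr
      _ = _ := by ring
  have k10 : n ^ 45 ≤ T ^ 4 * E ^ 9 * d ^ 2 := by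
    calc n ^ 45 = n ^ 18 * (n ^ 3) ^ 9 := by ring
      _ ≤ n ^ 18 * (Φ ^ 2 * E) ^ 9 := by
          gcongr
      _ = (n ^ 18 * Φ ^ 18) * E ^ 9 := by ring
      _ ≤ (d ^ 2 * T ^ 4) * E ^ 9 := by gcongr
      _ = _ := by ring
  exact k10

set_option maxHeartbeats 800000 in
lemma main_bound (A : Finset G) (Z : G → Finset G) (op : G → G → G)
    (hop : (∀ a b a' b', op a b = op a' b' ↔ a - a' = b - b') ∨
      (∀ a b a' b', op a b = op a' b' ↔ a - a' = b' - b))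
    (hz : ∀ x, ∀ a ∈ A, ∀ b ∈ A, b + x ∈ A → op a b ∈ Z x) :
    A.card ^ 45 ≤ (∑ x ∈ A - A, (Z x).card ^ 3) ^ 4 * energy A ^ 9 * (A - A).card ^ 2 := by
  set s : G → ℝ := fun x => ((Z x).card : ℝ) with hs
  have hs0 : ∀ x, 0 ≤ s x := fun x => Nat.cast_nonneg _
  set n : ℝ := (A.card : ℝ) with hn
  have hn0 : 0 ≤ n := Nat.cast_nonneg _
  set Φ := ∑ a ∈ A, ph A a with hΦ
  have hΦ0 : 0 ≤ Φ := Finset.sum_nonneg fun _ _ => ph_nonneg _ _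
  have hCS : ∀ x (g : G → ℝ), (∀ a, 0 ≤ g a) → ((∑ a ∈ A, g a) * cc A x) ^ 2 ≤
      s x * wQ A g (fun b => ph A b * ph A (b + x)) := by
    intro x g hg
    apply cs_wQ A (Z x) g _ op hop hg (fun b => mul_nonneg (ph_nonneg _ _) (ph_nonneg _ _))
    intro a ha b hb hne
    apply hz x a ha b hb
    by_contra h
    exact hne (by simp [ph_zero A _ h])
  have k1 : ∀ x, n ^ 2 * cc A x ≤ s x := by
    intro x
    have h := hCS x (fun _ => 1) (fun _ => zero_le_one)
    have h2 : (n * cc A x) ^ 2 ≤ s x * cc A x := by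
      have h3 : (n * cc A x) ^ 2 ≤ s x * wQ A (fun _ => 1) (fun b => ph A b * ph A (b + x)) := by
        simpa using h
      exact h3.trans (mul_le_mul_of_nonneg_left (wQ_one A x) (hs0 x))
    rcases (cc_nonneg A x).eq_or_lt with h0 | h0
    · rw [← h0]; simpa using hs0 x
    · apply le_of_mul_le_mul_right _ h0
      calc _ = (n * cc A x) ^ 2 := by ring
        _ ≤ _ := h2
  have k2 : ∀ x, (Φ * cc A x) ^ 2 ≤ s x * FF A x := fun x => hCS x (ph A) (ph_nonneg A)
  have hF0 : ∀ x, 0 ≤ FF A x := by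
    intro x
    unfold FF wQ
    refine Finset.sum_nonneg fun b _ => Finset.sum_nonneg fun b' _ =>
      Finset.sum_nonneg fun a _ => Finset.sum_nonneg fun a' _ => ?_
    have h := ph_nonneg A
    split_ifs
    · exact mul_nonneg (mul_nonneg (h _) (h _))
        (mul_nonneg (mul_nonneg (h _) (h _)) (mul_nonneg (h _) (h _)))
    · rfl
  have k4 : ∑ x ∈ A - A, cc A x = Φ ^ 2 := by
    have := sum_cc A (fun _ => 1)
    simp only [mul_one, one_mul] at this
    rw [← this, hΦ, sq, Finset.sum_mul_sum, Finset.sum_comm]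
  set C := ∑ x ∈ A - A, cc A x ^ 3 with hC
  have hC0 : 0 ≤ C := Finset.sum_nonneg fun x _ => pow_nonneg (cc_nonneg A x) 3
  set T := ∑ x ∈ A - A, s x ^ 3 with hT
  have hT0 : 0 ≤ T := Finset.sum_nonneg fun x _ => pow_nonneg (hs0 x) 3
  have k5 : n ^ 6 * C ≤ T := by
    rw [hC, Finset.mul_sum]
    apply Finset.sum_le_sum; intro x _
    calc _ = (n ^ 2 * cc A x) ^ 3 := by ring
      _ ≤ _ := pow_le_pow_left₀ (mul_nonneg (by positivity) (cc_nonneg A x)) (k1 x) 3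
  set d : ℝ := ((A - A).card : ℝ) with hd
  have hd0 : 0 ≤ d := Nat.cast_nonneg _
  have k6 : (Φ ^ 3) ^ 2 ≤ (∑ x ∈ A - A, s x) * C := by
    have := Finset.sum_sq_le_sum_mul_sum_of_sq_le_mul (A - A) (r := fun x => Φ * cc A x)
      (f := s) (g := FF A) (fun x _ => hs0 x) (fun x _ => hF0 x) (fun x _ => k2 x)
    rw [← Finset.mul_sum, k4, sum_FF] at this
    calc _ = (Φ * Φ ^ 2) ^ 2 := by ring
      _ ≤ _ := this
  have hS0 : 0 ≤ ∑ x ∈ A - A, s x := Finset.sum_nonneg fun x _ => hs0 x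
  have k7 : (∑ x ∈ A - A, s x) ^ 3 ≤ d ^ 2 * T := by
    exact pow_sum_le_card_mul_sum_pow (fun x _ => hs0 x) 2
  have k10 : n ^ 45 ≤ T ^ 4 * (energy A : ℝ) ^ 9 * d ^ 2 :=
    final_arith n Φ d T C _ _ hn0 hΦ0 hT0 hC0 hS0 (Nat.cast_nonneg _) k5 k6 k7 (Phi_bound A)
  simp only [hn, hT, hd, hs] at k10
  exact_mod_cast k10

lemma cube_bound (D B : Finset G) (h0 : (0 : G) ∈ D) :
    B.card ^ 12 ≤ (∑ x ∈ D, (stab B x).card ^ 3) ^ 4 := by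
  have h1 : (stab B 0).card ^ 3 ≤ ∑ x ∈ D, (stab B x).card ^ 3 :=
    Finset.single_le_sum (f := fun x => (stab B x).card ^ 3) (fun _ _ => Nat.zero_le _) h0
  have h2 : stab B 0 = B := by ext y; simp [mem_stab]
  rw [h2] at h1
  calc B.card ^ 12 = (B.card ^ 3) ^ 4 := by ring
    _ ≤ _ := Nat.pow_le_pow_left h1 4

theorem stmt_9 (A : Finset G) (hA : A.Nonempty) :
    (A - A).card ^ 12 ≤ (∑ x ∈ A - A, (stab (A - A) x).card ^ 3) ^ 4 ∧
    A.card ^ 45 ≤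
      (∑ x ∈ A - A, (stab (A - A) x).card ^ 3) ^ 4 * energy A ^ 9 * (A - A).card ^ 2 ∧
    (A + A).card ^ 12 ≤ (∑ x ∈ A - A, (stab (A + A) x).card ^ 3) ^ 4 ∧
    A.card ^ 45 ≤
      (∑ x ∈ A - A, (stab (A + A) x).card ^ 3) ^ 4 * energy A ^ 9 * (A - A).card ^ 2 := by
  obtain ⟨a0, ha0⟩ := hA
  have h0 : (0 : G) ∈ A - A := by
    have := Finset.sub_mem_sub ha0 ha0
    rwa [sub_self] at this
  refine ⟨cube_bound _ _ h0, ?_, cube_bound _ _ h0, ?_⟩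
  · apply main_bound A (fun x => stab (A - A) x) (fun a b => b - a)
    · left
      intro a b a' b'
      constructor
      · intro h
        rw [sub_eq_sub_iff_add_eq_add] at h ⊢
        rw [add_comm, ← h, add_comm]
      · intro h
        rw [sub_eq_sub_iff_add_eq_add] at h ⊢
        rw [add_comm b a', add_comm b' a, h, add_comm]
    · intro x a ha b hb hbx
      rw [mem_stab]
      refine ⟨Finset.sub_mem_sub hb ha, ?_⟩
      have : b - a + x = (b + x) - a := by abel
      rw [this]
      exact Finset.sub_mem_sub hbx ha
  · apply main_bound A (fun x => stab (A + A) x) (fun a b => a + b)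
    · right
      intro a b a' b'
      rw [sub_eq_sub_iff_add_eq_add, add_comm b' a']
    · intro x a ha b hb hbx
      rw [mem_stab]
      refine ⟨Finset.add_mem_add ha hb, ?_⟩
      rw [add_assoc]
      exact Finset.add_mem_add ha hbx
end

section
/- There exists an absolute constant c > 0 with the following property. Let G be an abelian group, A a finite nonempty subset of G, D = A − A, S = A + A, and β, γ ∈ (0,1] with β ≤ 1/2. If A is (2,β,γ)-connected, then E₃(D,A,A)² ≥ c·γ·|A|⁵·E(A) and E₃(S,A,A)² ≥ c·γ·|A|⁵·E(A). -/
open Finset Pointwise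

universe u

variable {G : Type*} [AddCommGroup G] [DecidableEq G]

/-- `E₃(B,A,A) = ∑_{x ∈ G} |B ∩ (B - x)| ⬝ |A ∩ (A - x)|²`
(the summand vanishes off `B - B`). -/
def energy3b (B A : Finset G) : ℕ := ∑ x ∈ B - B, (stab B x).card * (stab A x).card ^ 2

/-- `(2, β, γ)`-connectedness: every `B ⊆ A` with `|B| ≥ β|A|` satisfies
`E(B) ≥ γ (|B|/|A|)⁴ E(A)`. -/
def conn2 (β γ : ℝ) (A : Finset G) : Prop :=
  ∀ B ⊆ A, β * (A.card : ℝ) ≤ (B.card : ℝ) →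
    γ * ((B.card : ℝ) / (A.card : ℝ)) ^ 4 * (energy A : ℝ) ≤ (energy B : ℝ)

lemma mem_stab10 (A : Finset G) (s x : G) : x ∈ stab A s ↔ x ∈ A ∧ x + s ∈ A := by
  unfold stab
  simp only [mem_inter, mem_image]
  constructor
  · rintro ⟨h, a, ha, rfl⟩
    exact ⟨h, by simpa using ha⟩
  · rintro ⟨h, h2⟩
    exact ⟨h, x + s, h2, by simp⟩

lemma stab_neg10 (A : Finset G) (s : G) : (stab A (-s)).card = (stab A s).card := by
  apply Finset.card_bij (fun x _ => x - s)
  · intro a ha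
    rw [mem_stab10] at *
    refine ⟨by simpa [sub_eq_add_neg] using ha.2, by simpa using ha.1⟩
  · intro a _ b _ h
    simpa using h
  · intro b hb
    rw [mem_stab10] at hb
    exact ⟨b + s, by rw [mem_stab10]; simpa using hb.symm, by simp⟩

/-- sum over pairs versus sum over differences -/
lemma sum_diff10 (A : Finset G) (g : G → ℝ) (b : G) (hb : b ∈ A) :
    ∑ x ∈ A - A, (if b + x ∈ A then (1:ℝ) else 0) * g x = ∑ c ∈ A, g (c - b) := by
  simp only [ite_mul, one_mul, zero_mul]
  rw [← Finset.sum_filter]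
  symm
  apply Finset.sum_bij (fun c _ => c - b)
  · intro c hc
    simp only [mem_filter, add_sub_cancel, hc, and_true]
    exact sub_mem_sub hc hb
  · intro a _ c _ h
    simpa using h
  · intro x hx
    simp only [mem_filter] at hx
    exact ⟨b + x, hx.2, by simp⟩
  · intros; rfl

lemma cs10 {X Z : Type*} (X' : Finset X) (Z' : Finset Z) (t r : X → Z → ℝ) (p q : X → ℝ)
    (ht : ∀ x ∈ X', ∀ z ∈ Z', t x z * r x z = r x z) (ht2 : ∀ x z, t x z ^ 2 = t x z) :
    (∑ x ∈ X', ∑ z ∈ Z', r x z * (p x * q x)) ^ 2 ≤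
      (∑ x ∈ X', ∑ z ∈ Z', t x z * p x ^ 2) * (∑ x ∈ X', ∑ z ∈ Z', r x z ^ 2 * q x ^ 2) := by
  have h := Finset.sum_mul_sq_le_sq_mul_sq (X' ×ˢ Z') (fun w => t w.1 w.2 * p w.1)
    (fun w => r w.1 w.2 * q w.1)
  simp only [Finset.sum_product] at h
  refine le_of_eq_of_le ?_ (h.trans_eq ?_)
  · congr 1
    refine Finset.sum_congr rfl fun x hx => Finset.sum_congr rfl fun z hz => ?_
    have := ht x hx z hz
    linear_combination (-(p x * q x)) * this
  · simp only [mul_pow, ht2]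

lemma core10 (A V B : Finset G) (hB : B ⊆ A) (hBn : B.Nonempty) (hV : V.card = A.card)
    (hP : ∀ b ∈ A, ∀ b' ∈ A, (((A + V).filter (fun z => z - b ∈ V ∧ z - b' ∈ V)).card : ℝ)
      ≤ ((stab A (b' - b)).card : ℝ)) (τ : ℝ)
    (hτ : ∀ b ∈ B, ∑ c ∈ A, ((stab A (c - b)).card : ℝ) ≤ τ) :
    (A.card : ℝ) ^ 4 * (∑ b ∈ B, ∑ c ∈ A, ((stab A (c - b)).card : ℝ)) ^ 2 ≤
      (energy3b (A + V) A : ℝ) ^ 2 * τ := by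
  set p : G → ℝ := fun x => ((stab A x).card : ℝ) with hp
  have hp0 : ∀ x, 0 ≤ p x := fun x => by positivity
  have hpn : ∀ x y, p (x - y) = p (y - x) := fun x y => by
    simp only [hp]; rw [← neg_sub, stab_neg10]
  set i : G → G → ℝ := fun b x => if b + x ∈ A then (1:ℝ) else 0 with hi
  set j : G → G → ℝ := fun b z => if z - b ∈ V then (1:ℝ) else 0 with hj
  set t : G → G → ℝ := fun x z => if z + x ∈ A + V then (1:ℝ) else 0 with htd
  set r : G → G → ℝ := fun x z => ∑ b ∈ B, i b x * j b z with hr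
  set E3 : ℝ := ∑ x ∈ A - A, ∑ z ∈ A + V, t x z * p x ^ 2 with hE3
  have hi0 : ∀ b x, 0 ≤ i b x := fun b x => by simp only [hi]; split_ifs <;> norm_num
  have hi2 : ∀ b x, i b x ^ 2 = i b x := fun b x => by simp only [hi]; split_ifs <;> norm_num
  have hj0 : ∀ b x, 0 ≤ j b x := fun b x => by simp only [hj]; split_ifs <;> norm_num
  have hE30 : 0 ≤ E3 := by
    refine Finset.sum_nonneg fun x _ => Finset.sum_nonneg fun z _ => mul_nonneg ?_ (sq_nonneg _)
    simp only [htd]; split_ifs <;> norm_num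
  have hE3le : E3 ≤ (energy3b (A + V) A : ℝ) := by
    unfold energy3b
    push_cast
    have key : ∀ x, ∑ z ∈ A + V, t x z * p x ^ 2 =
        ((stab (A + V) x).card : ℝ) * ((stab A x).card : ℝ) ^ 2 := by
      intro x
      rw [← Finset.sum_mul]
      congr 1
      simp only [htd]
      rw [← Finset.sum_filter, Finset.sum_const, nsmul_eq_mul, mul_one]
      congr 2
      ext z
      simp [mem_stab10]
    rw [hE3, Finset.sum_congr rfl (fun x _ => key x)]
    refine Finset.sum_le_sum_of_subset_of_nonneg ?_ (fun _ _ _ => by positivity)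
    intro x hx
    obtain ⟨a, ha, b, hb, rfl⟩ := mem_sub.1 hx
    have : V.Nonempty := by
      rw [← Finset.card_pos, hV, Finset.card_pos]; exact ⟨a, ha⟩
    obtain ⟨v, hv⟩ := this
    exact mem_sub.2 ⟨a + v, add_mem_add ha hv, b + v, add_mem_add hb hv, by abel⟩
  have ht : ∀ x ∈ A - A, ∀ z ∈ A + V, t x z * r x z = r x z := by
    intro x _ z _
    simp only [hr, Finset.mul_sum]
    refine Finset.sum_congr rfl fun b _ => ?_
    simp only [htd, hi, hj]
    by_cases h1 : b + x ∈ A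
    · by_cases h2 : z - b ∈ V
      · have : z + x ∈ A + V := mem_add.2 ⟨b + x, h1, z - b, h2, by abel⟩
        simp [this]
      · simp [h2]
    · simp [h1]
  have ht2 : ∀ x z, t x z ^ 2 = t x z := fun b x => by simp only [htd]; split_ifs <;> norm_num
  have hjs : ∀ b ∈ A, ∑ z ∈ A + V, j b z = (A.card : ℝ) := by
    intro b hb
    simp only [hj]
    rw [← Finset.sum_filter, Finset.sum_const, nsmul_eq_mul, mul_one, ← hV]
    congr 1
    symm
    apply Finset.card_bij (fun v _ => b + v)
    · intro v hv
      simp only [mem_filter, add_sub_cancel_left, hv, and_true]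
      exact add_mem_add hb hv
    · intro a _ c _ h
      simpa using h
    · intro z hz
      simp only [mem_filter] at hz
      exact ⟨z - b, hz.2, by simp⟩
  have hjj : ∀ b ∈ A, ∀ b' ∈ A, ∑ z ∈ A + V, j b z * j b' z ≤ p (b' - b) := by
    intro b hb b' hb'
    refine le_of_eq_of_le ?_ (hP b hb b' hb')
    simp only [hj]
    rw [Finset.card_filter]
    push_cast
    refine Finset.sum_congr rfl fun z _ => ?_
    by_cases h1 : z - b ∈ V <;> by_cases h2 : z - b' ∈ V <;> simp [h1, h2]
  have hii : ∀ b ∈ A, ∀ b' ∈ A, ∑ x ∈ A - A, i b x * i b' x ≤ p (b' - b) := by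
    intro b hb b' hb'
    have h1 := sum_diff10 A (i b') b hb
    simp only [hi] at h1 ⊢
    rw [h1, ← Finset.sum_filter, Finset.sum_const, nsmul_eq_mul, mul_one]
    simp only [hp]
    apply le_of_eq
    congr 2
    ext z
    simp only [mem_filter, mem_stab10]
    rw [show b' + (z - b) = z + (b' - b) by abel]
  have hfirst : ∀ g : G → ℝ, ∑ x ∈ A - A, ∑ z ∈ A + V, r x z * g x =
      A.card * ∑ b ∈ B, ∑ c ∈ A, g (c - b) := by
    intro g
    have h1 : ∀ b ∈ B, ∑ c ∈ A, g (c - b) = ∑ x ∈ A - A, i b x * g x := fun b hb =>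
      (sum_diff10 A g b (hB hb)).symm
    rw [Finset.sum_congr rfl h1, Finset.sum_comm (s := B), Finset.mul_sum]
    refine Finset.sum_congr rfl fun x _ => ?_
    rw [← Finset.sum_mul]
    simp only [hr]
    rw [Finset.sum_comm, Finset.mul_sum, Finset.sum_mul]
    refine Finset.sum_congr rfl fun b hb => ?_
    rw [← Finset.mul_sum, hjs b (hB hb)]
    ring
  have hsec : ∀ g : G → ℝ, (∀ x, 0 ≤ g x) → ∑ x ∈ A - A, ∑ z ∈ A + V, r x z ^ 2 * g x ≤
      ∑ x ∈ A - A, (∑ b ∈ B, ∑ b' ∈ B, i b x * i b' x * p (b' - b)) * g x := by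
    intro g hg
    refine Finset.sum_le_sum fun x _ => ?_
    rw [← Finset.sum_mul]
    refine mul_le_mul_of_nonneg_right ?_ (hg x)
    simp only [hr, sq, Finset.sum_mul_sum]
    rw [Finset.sum_comm]
    refine Finset.sum_le_sum fun b hb => ?_
    rw [Finset.sum_comm]
    refine Finset.sum_le_sum fun b' hb' => ?_
    calc ∑ z ∈ A + V, i b x * j b z * (i b' x * j b' z)
        = i b x * i b' x * ∑ z ∈ A + V, j b z * j b' z := by
          rw [Finset.mul_sum]; exact Finset.sum_congr rfl fun z _ => by ring
      _ ≤ _ := mul_le_mul_of_nonneg_left (hjj b (hB hb) b' (hB hb'))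
          (mul_nonneg (hi0 _ _) (hi0 _ _))
  set F : ℝ := ∑ b ∈ B, ∑ c ∈ A, p (c - b) with hF
  set L : ℝ := ∑ b ∈ B, ∑ c ∈ A, p (c - b) ^ 2 with hL
  have hK1 : ∑ x ∈ A - A, ∑ z ∈ A + V, r x z ^ 2 * (1:ℝ) ^ 2 ≤ L := by
    refine (hsec (fun _ => (1:ℝ) ^ 2) (by simp)).trans ?_
    simp only [one_pow, mul_one]
    rw [Finset.sum_comm, hL]
    refine Finset.sum_le_sum fun b hb => ?_
    rw [Finset.sum_comm]
    refine le_trans (b := ∑ b' ∈ B, p (b' - b) ^ 2) ?_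
      (Finset.sum_le_sum_of_subset_of_nonneg hB fun _ _ _ => sq_nonneg _)
    refine Finset.sum_le_sum fun b' hb' => ?_
    rw [← Finset.sum_mul, sq]
    exact mul_le_mul_of_nonneg_right (hii b (hB hb) b' (hB hb')) (hp0 _)
  have hτB : ∀ b ∈ B, ∑ b' ∈ B, p (b' - b) ≤ τ := fun b hb =>
    (Finset.sum_le_sum_of_subset_of_nonneg hB fun _ _ _ => hp0 _).trans (hτ b hb)
  have hK2 : ∑ x ∈ A - A, ∑ z ∈ A + V, r x z ^ 2 * p x ^ 2 ≤ τ * L := by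
    refine (hsec (fun x => p x ^ 2) (fun _ => sq_nonneg _)).trans ?_
    have hLx : τ * L = ∑ x ∈ A - A, (τ * ∑ b ∈ B, i b x) * p x ^ 2 := by
      have h1 : ∀ b ∈ B, ∑ c ∈ A, p (c - b) ^ 2 = ∑ x ∈ A - A, i b x * p x ^ 2 := fun b hb =>
        (sum_diff10 A (fun x => p x ^ 2) b (hB hb)).symm
      rw [hL, Finset.sum_congr rfl h1, Finset.sum_comm (s := B), Finset.mul_sum]
      refine Finset.sum_congr rfl fun x _ => ?_
      rw [← Finset.sum_mul]; ring
    rw [hLx]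
    refine Finset.sum_le_sum fun x _ => mul_le_mul_of_nonneg_right ?_ (sq_nonneg _)
    have h1 : ∑ b ∈ B, ∑ b' ∈ B, i b x * p (b' - b) ≤ τ * ∑ b ∈ B, i b x := by
      rw [Finset.mul_sum]
      refine Finset.sum_le_sum fun b hb => ?_
      rw [← Finset.mul_sum, mul_comm]
      exact mul_le_mul_of_nonneg_right (hτB b hb) (hi0 _ _)
    refine le_trans ?_ h1
    refine Finset.sum_le_sum fun b _ => Finset.sum_le_sum fun b' _ => ?_
    refine mul_le_mul_of_nonneg_right ?_ (hp0 _)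
    simp only [hi]
    split_ifs <;> norm_num
  have c1 := cs10 (A - A) (A + V) t r p (fun _ => (1:ℝ)) ht ht2
  have c2 := cs10 (A - A) (A + V) t r p p ht ht2
  rw [hfirst (fun x => p x * 1)] at c1
  rw [hfirst (fun x => p x * p x)] at c2
  simp only [mul_one] at c1
  simp only [← sq] at c2
  rw [← hF] at c1
  rw [← hL] at c2
  have d1 : ((A.card : ℝ) * F) ^ 2 ≤ E3 * L := c1.trans
    (mul_le_mul_of_nonneg_left (by simpa using hK1) hE30)
  have d2 : ((A.card : ℝ) * L) ^ 2 ≤ E3 * (τ * L) := c2.trans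
    (mul_le_mul_of_nonneg_left hK2 hE30)
  have hL0 : 0 ≤ L := Finset.sum_nonneg fun _ _ => Finset.sum_nonneg fun _ _ => sq_nonneg _
  have hτ0 : 0 ≤ τ := by
    obtain ⟨b, hb⟩ := hBn
    exact (Finset.sum_nonneg fun _ _ => hp0 _).trans (hτB b hb)
  have d3 : (A.card : ℝ) ^ 2 * L ≤ E3 * τ := by
    rcases hL0.eq_or_lt with h | h
    · rw [← h]; simpa using mul_nonneg hE30 hτ0
    · refine le_of_mul_le_mul_right ?_ h
      linarith
  calc (A.card : ℝ) ^ 4 * F ^ 2 = (A.card : ℝ) ^ 2 * ((A.card : ℝ) * F) ^ 2 := by ring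
    _ ≤ (A.card : ℝ) ^ 2 * (E3 * L) := mul_le_mul_of_nonneg_left d1 (by positivity)
    _ = E3 * ((A.card : ℝ) ^ 2 * L) := by ring
    _ ≤ E3 * (E3 * τ) := mul_le_mul_of_nonneg_left d3 hE30
    _ = E3 ^ 2 * τ := by ring
    _ ≤ _ := mul_le_mul_of_nonneg_right (pow_le_pow_left₀ hE30 hE3le 2) hτ0

/-- Greedy removal of the heaviest elements. -/
lemma greedy10 {α : Type*} [DecidableEq α] (w : α → ℝ) (Λ : ℝ) (A : Finset α)
    (hw : ∀ a ∈ A, 0 < w a)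
    (h : ∀ C ⊆ A, C.Nonempty → ∀ τ, (∀ b ∈ C, w b ≤ τ) → (∑ b ∈ C, w b) ^ 2 ≤ Λ * τ)
    (m : ℕ) (hm : 1 ≤ m) (k : ℕ) :
    ∀ B ⊆ A, B.card = m + k → ∃ C ⊆ B, C.card = m ∧
      Λ / (∑ b ∈ B, w b) + k ≤ Λ / (∑ b ∈ C, w b) := by
  induction k with
  | zero => intro B _ hc; exact ⟨B, subset_rfl, by simpa using hc, by simp⟩
  | succ k ih =>
    intro B hBA hc
    have hBn : B.Nonempty := by rw [← Finset.card_pos]; omega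
    obtain ⟨b, hb, hmax⟩ := B.exists_max_image w hBn
    have hc' : (B.erase b).card = m + k := by rw [Finset.card_erase_of_mem hb]; omega
    obtain ⟨C, hC, hCm, hle⟩ := ih (B.erase b) ((erase_subset _ _).trans hBA) hc'
    refine ⟨C, hC.trans (erase_subset _ _), hCm, le_trans ?_ hle⟩
    have hs := Finset.add_sum_erase B w hb
    have hF' : 0 < ∑ x ∈ B.erase b, w x := by
      apply Finset.sum_pos (fun x hx => hw x (hBA (mem_of_mem_erase hx)))
      rw [← Finset.card_pos]; omega
    have hwb := hw b (hBA hb)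
    have h2 := h B hBA hBn (w b) hmax
    rw [← hs] at h2 ⊢
    set F' := ∑ x ∈ B.erase b, w x
    push_cast
    have : 1 ≤ Λ / F' - Λ / (w b + F') := by
      rw [div_sub_div _ _ hF'.ne' (by positivity), le_div_iff₀ (by positivity)]
      nlinarith
    linarith

lemma energy_eq10 (C : Finset G) :
    (energy C : ℝ) = ∑ b ∈ C, ∑ c ∈ C, ((stab C (c - b)).card : ℝ) := by
  unfold energy energyK
  push_cast
  rw [← Finset.sum_congr rfl (fun b hb => sum_diff10 C (fun x => ((stab C x).card : ℝ)) b hb),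
    Finset.sum_comm]
  refine Finset.sum_congr rfl fun x _ => ?_
  rw [← Finset.sum_mul, sq]
  congr 1
  rw [← Finset.sum_filter, Finset.sum_const, nsmul_eq_mul, mul_one]
  congr 2
  ext z
  simp [mem_stab10]

lemma main10 (A V : Finset G) (β γ : ℝ) (hA : A.Nonempty) (hβ : β ≤ 1 / 2) (hγ : 0 < γ)
    (hconn : conn2 β γ A) (hV : V.card = A.card)
    (hP : ∀ b ∈ A, ∀ b' ∈ A, (((A + V).filter (fun z => z - b ∈ V ∧ z - b' ∈ V)).card : ℝ)
      ≤ ((stab A (b' - b)).card : ℝ)) :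
    1 / 32 * γ * (A.card : ℝ) ^ 5 * (energy A : ℝ) ≤ (energy3b (A + V) A : ℝ) ^ 2 := by
  have hn : 0 < A.card := Finset.card_pos.2 hA
  have hnR : (0:ℝ) < A.card := by exact_mod_cast hn
  set w : G → ℝ := fun b => ∑ c ∈ A, ((stab A (c - b)).card : ℝ) with hwd
  set Λ : ℝ := (energy3b (A + V) A : ℝ) ^ 2 / (A.card : ℝ) ^ 4 with hΛ
  have hw : ∀ a ∈ A, 0 < w a := by
    intro a ha
    refine Finset.sum_pos' (fun _ _ => by positivity) ⟨a, ha, ?_⟩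
    have : a ∈ stab A (a - a) := by rw [mem_stab10]; simpa using ha
    exact_mod_cast Finset.card_pos.2 ⟨a, this⟩
  have h : ∀ C ⊆ A, C.Nonempty → ∀ τ, (∀ b ∈ C, w b ≤ τ) → (∑ b ∈ C, w b) ^ 2 ≤ Λ * τ := by
    intro C hC hCn τ hτ
    have := core10 A V C hC hCn hV hP τ hτ
    rw [hΛ, div_mul_eq_mul_div, le_div_iff₀ (by positivity), mul_comm]
    exact this
  obtain ⟨k, m, hkm, hm1, hm2, hk2⟩ : ∃ k m : ℕ, A.card = m + k ∧ 1 ≤ m ∧ A.card ≤ 2 * m ∧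
      A.card ≤ 2 * (k + 1) :=
    ⟨A.card / 2, A.card - A.card / 2, by omega, by omega, by omega, by omega⟩
  obtain ⟨C, hC, hCm, hle⟩ := greedy10 w Λ A hw h m hm1 k A subset_rfl hkm
  have hm2R : (A.card : ℝ) ≤ 2 * m := by exact_mod_cast hm2
  have hk2R : (A.card : ℝ) ≤ 2 * (k + 1) := by exact_mod_cast hk2
  have hCn : C.Nonempty := by rw [← Finset.card_pos]; omega
  have hFA : 0 < ∑ b ∈ A, w b := Finset.sum_pos hw hA
  have hFC : 0 < ∑ b ∈ C, w b := Finset.sum_pos (fun b hb => hw b (hC hb)) hCn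
  have h1 : 1 ≤ Λ / ∑ b ∈ A, w b := by
    rw [le_div_iff₀ hFA, one_mul]
    have := h A subset_rfl hA (∑ b ∈ A, w b)
      (fun b hb => Finset.single_le_sum (fun x hx => (hw x hx).le) hb)
    rw [sq] at this
    exact le_of_mul_le_mul_right this hFA
  have h2 : (k + 1 : ℝ) * ∑ b ∈ C, w b ≤ Λ := by
    rw [← le_div_iff₀ hFC]; linarith
  have h3 : (energy C : ℝ) ≤ ∑ b ∈ C, w b := by
    rw [energy_eq10]
    refine Finset.sum_le_sum fun b _ => ?_
    refine le_trans (Finset.sum_le_sum fun c _ => ?_)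
      (Finset.sum_le_sum_of_subset_of_nonneg hC fun _ _ _ => by positivity)
    have : stab C (c - b) ⊆ stab A (c - b) := by
      intro z
      simp only [mem_stab10]
      exact fun hz => ⟨hC hz.1, hC hz.2⟩
    exact_mod_cast Finset.card_le_card this
  have h4 := hconn C hC (by rw [hCm]; nlinarith)
  have h5 : (1 / 16 : ℝ) ≤ ((C.card : ℝ) / A.card) ^ 4 := by
    have : (1 / 2 : ℝ) ≤ (C.card : ℝ) / A.card := by
      rw [le_div_iff₀ hnR, hCm]; linarith
    calc (1 / 16 : ℝ) = (1 / 2) ^ 4 := by norm_num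
      _ ≤ _ := pow_le_pow_left₀ (by norm_num) this 4
  have h6 : γ * (1 / 16) * (energy A : ℝ) ≤ ∑ b ∈ C, w b := by
    refine le_trans ?_ (h4.trans h3)
    gcongr
  have hE : 0 ≤ γ * (1 / 16) * (energy A : ℝ) := by positivity
  have h7 : (A.card : ℝ) / 2 * (γ * (1 / 16) * (energy A : ℝ)) ≤ Λ := by
    refine le_trans ?_ h2
    apply mul_le_mul _ h6 hE (by positivity)
    linarith
  rw [hΛ, le_div_iff₀ (by positivity)] at h7
  refine le_trans (le_of_eq ?_) h7
  ring

theorem stmt_10 :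
    ∃ c : ℝ, 0 < c ∧
      ∀ (G : Type u) [AddCommGroup G] [DecidableEq G] (A : Finset G) (β γ : ℝ),
        A.Nonempty →
        0 < β → β ≤ 1 / 2 → 0 < γ → γ ≤ 1 →
        conn2 β γ A →
        (c * γ * (A.card : ℝ) ^ 5 * (energy A : ℝ) ≤ (energy3b (A - A) A : ℝ) ^ 2) ∧
        (c * γ * (A.card : ℝ) ^ 5 * (energy A : ℝ) ≤ (energy3b (A + A) A : ℝ) ^ 2) := by
  refine ⟨1 / 32, by norm_num, ?_⟩
  intro G _ _ A β γ hA _ hβ hγ _ hconn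
  constructor
  · rw [sub_eq_add_neg A A]
    refine main10 A (-A) β γ hA hβ hγ hconn (Finset.card_neg A) ?_
    intro b _ b' _
    norm_cast
    apply Finset.card_le_card_of_injOn (fun z => b - z)
    · intro z hz
      simp only [coe_filter, Set.mem_ofPred_eq, Finset.mem_neg', neg_sub] at hz
      simp only [mem_coe, mem_stab10]
      refine ⟨hz.2.1, ?_⟩
      rw [show b - z + (b' - b) = b' - z by abel]
      exact hz.2.2
    · intro x _ y _ hxy
      simpa using hxy
  · refine main10 A A β γ hA hβ hγ hconn rfl ?_
    intro b _ b' _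
    norm_cast
    apply Finset.card_le_card_of_injOn (fun z => z - b')
    · intro z hz
      simp only [coe_filter, Set.mem_ofPred_eq] at hz
      simp only [mem_coe, mem_stab10]
      refine ⟨hz.2.2, ?_⟩
      rw [show z - b' + (b' - b) = z - b by abel]
      exact hz.2.1
    · intro x _ y _ hxy
      simpa using hxy
end

section
/- Let G be an abelian group and A, B finite nonempty subsets of G. Then there exist an integer s ≥ |A|·|B|²/(16·E(A,B)), elements b₁, …, b_s ∈ B, and pairwise disjoint sets A₁, …, A_s with A_j ⊆ A + b_j and |A_j| ≥ |A|/2 for every j ∈ {1,…,s}. -/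
open Finset Pointwise

variable {G : Type*} [AddCommGroup G] [DecidableEq G]

/-- The additive energy `E(A,B) = |{(a₁,a₂,b₁,b₂) ∈ A × A × B × B : a₁ + b₁ = a₂ + b₂}|`. -/
def energyAB (A B : Finset G) : ℕ :=
  (((A ×ˢ A) ×ˢ (B ×ˢ B)).filter (fun p => p.1.1 + p.2.1 = p.1.2 + p.2.2)).card

theorem key_bound (A B U : Finset G)
    (h : ∀ b ∈ B, (A.card : ℝ) / 2 ≤ (((A.image (fun a => a + b)) ∩ U).card : ℝ)) :
    ((A.card : ℝ) * B.card / 2) ^ 2 ≤ U.card * energyAB A B := by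
  set r : G → ℕ := fun x => (B.filter (fun b => x ∈ A.image (fun a => a + b))).card with hr
  have h1 : ∑ b ∈ B, ((A.image (fun a => a + b)) ∩ U).card = ∑ x ∈ U, r x := by
    have := Finset.sum_card_bipartiteAbove_eq_sum_card_bipartiteBelow
      (s := B) (t := U) (fun b x => x ∈ A.image (fun a => a + b))
    refine Eq.trans ?_ this
    refine Finset.sum_congr rfl fun b _ => ?_
    congr 1
    ext x
    simp only [Finset.mem_inter, Finset.mem_bipartiteAbove]
    tauto
  have h2 : ∑ x ∈ U, r x ^ 2 ≤ energyAB A B := by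
    have e : ∀ x ∈ U, r x ^ 2 = ((B.filter (fun b => x ∈ A.image (fun a => a + b))) ×ˢ
        (B.filter (fun b => x ∈ A.image (fun a => a + b)))).card := by
      intro x _
      rw [Finset.card_product, sq]
    rw [Finset.sum_congr rfl e, ← Finset.card_sigma]
    unfold energyAB
    refine Finset.card_le_card_of_injOn
      (fun p => ((p.1 - p.2.1, p.1 - p.2.2), (p.2.1, p.2.2))) ?_ ?_
    · rintro ⟨x, b₁, b₂⟩ hp
      simp only [Finset.coe_sigma, Set.mem_sigma_iff, Finset.mem_coe, Finset.mem_product,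
        Finset.mem_filter, Finset.mem_image] at hp
      obtain ⟨_, ⟨hb1, a, ha, rfl⟩, hb2, c, hc, hcx⟩ := hp
      simp only [Finset.mem_coe, Finset.mem_filter, Finset.mem_product]
      refine ⟨⟨⟨by simpa using ha, ?_⟩, hb1, hb2⟩, by abel⟩
      rw [← hcx]; simpa using hc
    · rintro ⟨x, b₁, b₂⟩ _ ⟨y, c₁, c₂⟩ _ hxy
      simp only [Prod.mk.injEq] at hxy
      obtain ⟨⟨h1, _⟩, rfl, rfl⟩ := hxy
      have : x = y := by simpa using h1
      subst this; rfl
  have h3 : (A.card : ℝ) * B.card / 2 ≤ ∑ x ∈ U, (r x : ℝ) := by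
    have := Finset.sum_le_sum h
    rw [Finset.sum_const, nsmul_eq_mul] at this
    have h1' : (∑ b ∈ B, (((A.image (fun a => a + b)) ∩ U).card : ℝ)) = ∑ x ∈ U, (r x : ℝ) := by
      exact_mod_cast h1
    rw [h1'] at this
    linarith
  have h4 : (∑ x ∈ U, (r x : ℝ)) ^ 2 ≤ U.card * ∑ x ∈ U, (r x : ℝ) ^ 2 :=
    sq_sum_le_card_mul_sum_sq
  have h5 : ∑ x ∈ U, (r x : ℝ) ^ 2 ≤ energyAB A B := by exact_mod_cast h2
  calc _ ≤ (∑ x ∈ U, (r x : ℝ)) ^ 2 := by gcongr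
    _ ≤ _ := h4
    _ ≤ _ := by gcongr

theorem stmt_12 (A B : Finset G) (hA : A.Nonempty) (hB : B.Nonempty) :
    ∃ (s : ℕ) (b : Fin s → G) (Aj : Fin s → Finset G),
      (A.card : ℝ) * (B.card : ℝ) ^ 2 / (16 * (energyAB A B : ℝ)) ≤ (s : ℝ) ∧
      (∀ j, b j ∈ B) ∧
      (∀ j, Aj j ⊆ A.image (fun a => a + b j)) ∧
      (∀ j, (A.card : ℝ) / 2 ≤ ((Aj j).card : ℝ)) ∧
      (∀ i j, i ≠ j → Disjoint (Aj i) (Aj j)) := by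
  set β : ℝ := (A.card : ℝ) * (B.card : ℝ) ^ 2 / (16 * (energyAB A B : ℝ)) with hβ
  have main : ∀ s : ℕ, s ≤ ⌈β⌉₊ → ∃ (b : Fin s → G) (Aj : Fin s → Finset G),
      (∀ j, b j ∈ B) ∧
      (∀ j, Aj j ⊆ A.image (fun a => a + b j)) ∧
      (∀ j, (A.card : ℝ) / 2 ≤ ((Aj j).card : ℝ)) ∧
      (∀ i j, i ≠ j → Disjoint (Aj i) (Aj j)) := by
    intro s
    induction s with
    | zero =>
      intro _
      exact ⟨Fin.elim0, Fin.elim0, fun j => j.elim0, fun j => j.elim0, fun j => j.elim0,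
        fun j => j.elim0⟩
    | succ s ih =>
      intro hs
      have hsβ : (s : ℝ) < β := Nat.lt_ceil.1 hs
      obtain ⟨b, Aj, hb, hsub, hcard, hdis⟩ := ih (by omega)
      set U : Finset G := Finset.univ.biUnion Aj with hU
      by_cases hex : ∃ c ∈ B, (A.card : ℝ) / 2 ≤ (((A.image (fun a => a + c)) \ U).card : ℝ)
      · obtain ⟨c, hc, hcU⟩ := hex
        have hd : ∀ j, Disjoint ((A.image (fun a => a + c)) \ U) (Aj j) := fun j =>
          Finset.disjoint_of_subset_right
            (Finset.subset_biUnion_of_mem Aj (Finset.mem_univ j)) Finset.sdiff_disjoint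
        refine ⟨Fin.cons c b, Fin.cons ((A.image (fun a => a + c)) \ U) Aj, ?_, ?_, ?_, ?_⟩
        · intro j
          refine Fin.cases ?_ (fun i => ?_) j
          · simpa using hc
          · simpa using hb i
        · intro j
          refine Fin.cases ?_ (fun i => ?_) j
          · simp only [Fin.cons_zero]; exact Finset.sdiff_subset
          · simpa only [Fin.cons_succ] using hsub i
        · intro j
          refine Fin.cases ?_ (fun i => ?_) j
          · simpa only [Fin.cons_zero] using hcU
          · simpa only [Fin.cons_succ] using hcard i
        · intro i j
          refine Fin.cases ?_ (fun i => ?_) i <;> refine Fin.cases ?_ (fun j => ?_) j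
          · intro h; exact absurd rfl h
          · intro _; simpa only [Fin.cons_zero, Fin.cons_succ] using hd j
          · intro _; simpa only [Fin.cons_zero, Fin.cons_succ] using (hd i).symm
          · intro h
            simp only [Fin.cons_succ]
            exact hdis i j (fun e => h (by rw [e]))
      · exfalso
        push Not at hex
        have hU1 : (U.card : ℝ) ≤ s * A.card := by
          have : U.card ≤ s * A.card := by
            refine (Finset.card_biUnion_le_card_mul _ _ A.card fun j _ => ?_).trans (by simp)
            exact (Finset.card_le_card (hsub j)).trans Finset.card_image_le
          exact_mod_cast this
        have key := key_bound A B U (fun c hc => by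
          have h1 := hex c hc
          have h2 := Finset.card_sdiff_add_card_inter (A.image (fun a => a + c)) U
          rw [Finset.card_image_of_injective A (add_left_injective c)] at h2
          have h3 : (((A.image (fun a => a + c)) \ U).card : ℝ)
            + (((A.image (fun a => a + c)) ∩ U).card : ℝ) = A.card := by exact_mod_cast h2
          linarith)
        have hE0 : (0 : ℝ) ≤ energyAB A B := Nat.cast_nonneg _
        have hs0 : (0 : ℝ) ≤ s := Nat.cast_nonneg _
        have hE : (0 : ℝ) < energyAB A B := by
          rcases hE0.eq_or_lt with h | h
          · rw [hβ, ← h] at hsβ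
            simp at hsβ
            linarith
          · exact h
        have hA0 : (0 : ℝ) < A.card := by exact_mod_cast hA.card_pos
        rw [hβ, lt_div_iff₀ (by positivity)] at hsβ
        have k2 : ((A.card : ℝ) * B.card / 2) ^ 2 ≤ s * A.card * energyAB A B :=
          key.trans (by gcongr)
        have k3 : (A.card : ℝ) * ((A.card : ℝ) * (B.card : ℝ) ^ 2) ≤
            A.card * (4 * (s * energyAB A B)) := by nlinarith
        have k4 := le_of_mul_le_mul_left k3 hA0
        have k5 : (0 : ℝ) ≤ s * energyAB A B := by positivity
        linarith
  obtain ⟨b, Aj, h⟩ := main ⌈β⌉₊ le_rfl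
  exact ⟨⌈β⌉₊, b, Aj, Nat.le_ceil β, h⟩
end

section
/- Let G be an abelian group and A, B finite nonempty subsets of G. Then (Σ_{s₁,s₂ ∈ G} |{x ∈ G : x ∈ A, x + s₁ ∈ B, x + s₂ ∈ A, x + s₁ + s₂ ∈ B}|²) · (|A|·|B|)⁴ ≥ E(A,B)⁴. -/
open Finset Pointwise

variable {G : Type*} [AddCommGroup G] [DecidableEq G]

theorem aux_count (S X Y : Finset G) (P : G → Finset G)
    (h : ∀ s ∈ S, ∀ x ∈ P s, x ∈ X ∧ x + s ∈ Y) :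
    ∑ s ∈ S, (P s).card ≤ X.card * Y.card := by
  rw [← Finset.card_sigma, ← Finset.card_product]
  apply Finset.card_le_card_of_injOn (fun p => (p.2, p.2 + p.1))
  · rintro ⟨s, x⟩ hp
    simp only [Finset.coe_sigma, Set.mem_sigma_iff, Finset.mem_coe] at hp
    simpa using h s hp.1 x hp.2
  · rintro ⟨s, x⟩ _ ⟨s', x'⟩ _ he
    simp only [Prod.mk.injEq] at he
    obtain ⟨rfl, h2⟩ := he
    have := add_left_cancel h2
    subst this
    rfl

def cubeN (A B : Finset G) (s t : G) : Finset G :=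
  A.filter fun x => x + s ∈ B ∧ x + t ∈ A ∧ x + s + t ∈ B

theorem energy_le (A B : Finset G) :
    energyAB A B ≤ ∑ p ∈ (B - A) ×ˢ (A - A), (cubeN A B p.1 p.2).card := by
  rw [← Finset.card_sigma, energyAB]
  apply Finset.card_le_card_of_injOn
    (fun q => (⟨(q.2.2 - q.1.1, q.1.2 - q.1.1), q.1.1⟩ : (_ : G × G) × G))
  · rintro ⟨⟨a1, a2⟩, ⟨b1, b2⟩⟩ hp
    simp only [Finset.coe_filter, Finset.mem_product, Set.mem_setOf_eq] at hp
    obtain ⟨⟨⟨h1, h2⟩, h3, h4⟩, h5⟩ := hp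
    have e : a1 + (b2 - a1) + (a2 - a1) = b1 := by
      have : b1 = a2 + b2 - a1 := by rw [← h5]; abel
      rw [this]; abel
    simp only [Finset.coe_sigma, Set.mem_sigma_iff, Finset.mem_coe, Finset.mem_product,
      cubeN, Finset.mem_filter, e]
    refine ⟨⟨sub_mem_sub h4 h1, sub_mem_sub h2 h1⟩, h1, ?_, ?_, h3⟩
    · simpa using h4
    · simpa using h2
  · rintro ⟨⟨a1, a2⟩, ⟨b1, b2⟩⟩ hp ⟨⟨a1', a2'⟩, ⟨b1', b2'⟩⟩ hp' he
    simp only [Finset.coe_filter, Finset.mem_product, Set.mem_setOf_eq] at hp hp'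
    simp only [Sigma.mk.injEq, Prod.mk.injEq, heq_eq_eq] at he
    obtain ⟨⟨e1, e2⟩, rfl⟩ := he
    have e1 := sub_left_injective e1
    have e2 := sub_left_injective e2
    subst e1 e2
    have := add_left_cancel (hp.2.trans hp'.2.symm)
    subst this
    rfl

theorem holder_aux {ι : Type*} (S : Finset ι) (N r c : ι → ℝ) (hN : ∀ i ∈ S, 0 ≤ N i)
    (hr : ∀ i ∈ S, 0 ≤ r i) (hc : ∀ i ∈ S, 0 ≤ c i)
    (hr0 : ∀ i ∈ S, r i = 0 → N i = 0) (hc0 : ∀ i ∈ S, c i = 0 → N i = 0) :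
    (∑ i ∈ S, N i) ^ 4 ≤ (∑ i ∈ S, N i ^ 2) * (∑ i ∈ S, r i * c i) *
      ((∑ i ∈ S, N i / r i) * (∑ i ∈ S, N i / c i)) := by
  have hs : ∀ i ∈ S, √(r i * c i) ^ 2 = r i * c i := fun i hi =>
    Real.sq_sqrt (mul_nonneg (hr i hi) (hc i hi))
  have h1 : (∑ i ∈ S, N i) ^ 2 ≤ (∑ i ∈ S, N i * √(r i * c i)) * (∑ i ∈ S, N i / √(r i * c i)) := by
    apply Finset.sum_sq_le_sum_mul_sum_of_sq_eq_mul
    · intro i hi; have := hN i hi; positivity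
    · intro i hi; have := hN i hi; positivity
    · intro i hi
      by_cases h : N i = 0
      · simp [h]
      have h1 : 0 < r i := lt_of_le_of_ne (hr i hi) (fun e => h (hr0 i hi e.symm))
      have h2 : 0 < c i := lt_of_le_of_ne (hc i hi) (fun e => h (hc0 i hi e.symm))
      have : 0 < √(r i * c i) := by positivity
      field_simp
  have h2 : (∑ i ∈ S, N i * √(r i * c i)) ^ 2 ≤ (∑ i ∈ S, N i ^ 2) * (∑ i ∈ S, r i * c i) := by
    apply Finset.sum_sq_le_sum_mul_sum_of_sq_eq_mul
    · intro i hi; positivity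
    · intro i hi; exact mul_nonneg (hr i hi) (hc i hi)
    · intro i hi
      rw [mul_pow, hs i hi]
  have h3 : (∑ i ∈ S, N i / √(r i * c i)) ^ 2 ≤ (∑ i ∈ S, N i / r i) * (∑ i ∈ S, N i / c i) := by
    apply Finset.sum_sq_le_sum_mul_sum_of_sq_eq_mul
    · intro i hi; exact div_nonneg (hN i hi) (hr i hi)
    · intro i hi; exact div_nonneg (hN i hi) (hc i hi)
    · intro i hi
      rw [div_pow, hs i hi, div_mul_div_comm, sq]
  calc (∑ i ∈ S, N i) ^ 4 = ((∑ i ∈ S, N i) ^ 2) ^ 2 := by ring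
    _ ≤ ((∑ i ∈ S, N i * √(r i * c i)) * (∑ i ∈ S, N i / √(r i * c i))) ^ 2 := by gcongr
    _ = (∑ i ∈ S, N i * √(r i * c i)) ^ 2 * (∑ i ∈ S, N i / √(r i * c i)) ^ 2 := by ring
    _ ≤ _ := mul_le_mul h2 h3 (sq_nonneg _) ((sq_nonneg _).trans h2)

theorem combine_aux {E S Q W U V M : ℝ} (hE : 0 ≤ E) (h1 : E ≤ S)
    (h2 : S ^ 4 ≤ Q * W * (U * V)) (hW : W ≤ M * M) (hU : U ≤ M) (hV : V ≤ M)
    (hQ : 0 ≤ Q) (hU0 : 0 ≤ U) (hV0 : 0 ≤ V) : E ^ 4 ≤ Q * M ^ 4 := by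
  have hM : 0 ≤ M := hU0.trans hU
  calc E ^ 4 ≤ S ^ 4 := pow_le_pow_left₀ hE h1 4
    _ ≤ _ := h2
    _ ≤ Q * (M * M) * (M * M) := by
      refine mul_le_mul (mul_le_mul_of_nonneg_left hW hQ)
        (mul_le_mul hU hV hV0 hM) (mul_nonneg hU0 hV0) (by positivity)
    _ = _ := by ring

set_option maxHeartbeats 2000000 in
theorem stmt_15 (A B : Finset G) (hA : A.Nonempty) (hB : B.Nonempty) :
    energyAB A B ^ 4 ≤
      (∑ s₁ ∈ B - A, ∑ s₂ ∈ A - A,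
          (A.filter fun x => x + s₁ ∈ B ∧ x + s₂ ∈ A ∧ x + s₁ + s₂ ∈ B).card ^ 2) *
        (A.card * B.card) ^ 4 := by
  change energyAB A B ^ 4 ≤ (∑ s₁ ∈ B - A, ∑ s₂ ∈ A - A, (cubeN A B s₁ s₂).card ^ 2) *
        (A.card * B.card) ^ 4
  rw [← Finset.sum_product' (B - A) (A - A) (fun s t => (cubeN A B s t).card ^ 2)]
  let R : G → Finset G := fun s => A.filter fun x => x + s ∈ B
  let a : G → Finset G := fun t => A.filter fun x => x + t ∈ A
  let b : G → Finset G := fun t => B.filter fun x => x + t ∈ B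
  have f1 : ∀ s, ∑ t ∈ A - A, (cubeN A B s t).card ≤ (R s).card * (R s).card := by
    intro s
    apply aux_count
    intro t _ x hx
    simp only [cubeN, Finset.mem_filter, R] at hx ⊢
    rw [add_right_comm]
    tauto
  have f2 : ∀ t, ∑ s ∈ B - A, (cubeN A B s t).card ≤ (a t).card * (b t).card := by
    intro t
    apply aux_count
    intro s _ x hx
    simp only [cubeN, Finset.mem_filter, a, b] at hx ⊢
    tauto
  have f3 : ∑ s ∈ B - A, (R s).card ≤ A.card * B.card := by
    apply aux_count
    intro s _ x hx
    simpa [R] using hx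
  have f4 : ∑ s ∈ A - A, (a s).card ≤ A.card * A.card := by
    apply aux_count
    intro s _ x hx
    simpa [a] using hx
  have f5 : ∑ s ∈ A - A, (b s).card ≤ B.card * B.card := by
    apply aux_count
    intro s _ x hx
    simpa [b] using hx
  have f6 := energy_le A B
  let c : G → ℝ := fun t => √((a t).card * (b t).card)
  have hc : ∀ t, c t ^ 2 = (a t).card * (b t).card := fun t => Real.sq_sqrt (by positivity)
  have hc' : ∀ t, 0 ≤ c t := fun t => Real.sqrt_nonneg _
  have g1 : ∀ s, ∑ t ∈ A - A, ((cubeN A B s t).card : ℝ) ≤ (R s).card * (R s).card := by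
    intro s; exact_mod_cast f1 s
  have g2 : ∀ t, ∑ s ∈ B - A, ((cubeN A B s t).card : ℝ) ≤ c t ^ 2 := by
    intro t; rw [hc]; exact_mod_cast f2 t
  have g3 : ∑ s ∈ B - A, ((R s).card : ℝ) ≤ A.card * B.card := by exact_mod_cast f3
  have g4 : ∑ s ∈ A - A, ((a s).card : ℝ) ≤ A.card * A.card := by exact_mod_cast f4
  have g5 : ∑ s ∈ A - A, ((b s).card : ℝ) ≤ B.card * B.card := by exact_mod_cast f5
  have g6 : (energyAB A B : ℝ) ≤ ∑ p ∈ (B - A) ×ˢ (A - A), ((cubeN A B p.1 p.2).card : ℝ) := by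
    exact_mod_cast f6
  have gc : ∑ t ∈ A - A, c t ≤ A.card * B.card := by
    have : (∑ t ∈ A - A, c t) ^ 2 ≤ (∑ s ∈ A - A, ((a s).card : ℝ)) * ∑ s ∈ A - A, ((b s).card : ℝ) := by
      apply Finset.sum_sq_le_sum_mul_sum_of_sq_eq_mul
      · intros; positivity
      · intros; positivity
      · intro i _; exact hc i
    refine (pow_le_pow_iff_left₀ (Finset.sum_nonneg fun _ _ => hc' _) (by positivity) two_ne_zero).1 ?_
    calc _ ≤ _ := this
      _ ≤ (A.card * A.card : ℝ) * (B.card * B.card) :=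
        mul_le_mul g4 g5 (Finset.sum_nonneg fun _ _ => Nat.cast_nonneg _) (mul_nonneg (Nat.cast_nonneg _) (Nat.cast_nonneg _))
      _ = _ := by ring
  have H := holder_aux ((B - A) ×ˢ (A - A)) (fun p => ((cubeN A B p.1 p.2).card : ℝ))
    (fun p => ((R p.1).card : ℝ)) (fun p => c p.2) (fun _ _ => by positivity)
    (fun _ _ => by positivity) (fun _ _ => hc' _)
    (by
      rintro ⟨s, t⟩ hp h
      simp only [Finset.mem_product] at hp
      dsimp only at h ⊢
      have h0 := (Finset.single_le_sum (f := fun t => ((cubeN A B s t).card : ℝ))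
        (fun _ _ => by positivity) hp.2).trans (g1 s)
      rw [h] at h0
      exact le_antisymm (by simpa using h0) (by positivity))
    (by
      rintro ⟨s, t⟩ hp h
      simp only [Finset.mem_product] at hp
      dsimp only at h ⊢
      have h0 := (Finset.single_le_sum (f := fun s => ((cubeN A B s t).card : ℝ))
        (fun _ _ => by positivity) hp.1).trans (g2 t)
      rw [h] at h0
      exact le_antisymm (by simpa using h0) (by positivity))
  have k1 : ∑ p ∈ (B - A) ×ˢ (A - A), ((R p.1).card : ℝ) * c p.2 ≤
      (A.card * B.card) * (A.card * B.card) := by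
    rw [Finset.sum_product]
    dsimp only
    rw [← Finset.sum_mul_sum]
    exact mul_le_mul g3 gc (Finset.sum_nonneg fun _ _ => hc' _) (by positivity)
  have k2 : ∑ p ∈ (B - A) ×ˢ (A - A), ((cubeN A B p.1 p.2).card : ℝ) / ((R p.1).card : ℝ) ≤
      A.card * B.card := by
    rw [Finset.sum_product]
    refine le_trans (Finset.sum_le_sum fun s _ => ?_) g3
    dsimp only
    rw [← Finset.sum_div]
    exact div_le_of_le_mul₀ (by positivity) (by positivity) (g1 s)
  have k3 : ∑ p ∈ (B - A) ×ˢ (A - A), ((cubeN A B p.1 p.2).card : ℝ) / c p.2 ≤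
      A.card * B.card := by
    rw [Finset.sum_product_right]
    refine le_trans (Finset.sum_le_sum fun t _ => ?_) gc
    dsimp only
    rw [← Finset.sum_div]
    exact div_le_of_le_mul₀ (hc' t) (hc' t) (by rw [← sq]; exact g2 t)
  have k0 : 0 ≤ ∑ p ∈ (B - A) ×ˢ (A - A), ((cubeN A B p.1 p.2).card : ℝ) / c p.2 :=
    Finset.sum_nonneg fun p _ => div_nonneg (by positivity) (hc' _)
  have final : (energyAB A B : ℝ) ^ 4 ≤
      (∑ p ∈ (B - A) ×ˢ (A - A), ((cubeN A B p.1 p.2).card : ℝ) ^ 2) *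
        (A.card * B.card) ^ 4 := by
    exact combine_aux (by positivity) g6 H k1 k2 k3
      (Finset.sum_nonneg fun _ _ => by positivity)
      (Finset.sum_nonneg fun _ _ => by positivity) k0
  exact_mod_cast final
end

section
/- Let Δ > 0 and C > 1 be real numbers, t ≥ 1 an integer, and M₁, …, M_t finite sets with Δ ≤ |M_j| ≤ C·Δ for every j ∈ {1,…,t}. Set σ := Σ_{i,j=1}^{t} |M_i ∩ M_j| and assume σ ≤ 10⁻⁴·t²·Δ. Then there exist an integer k ≥ t²·Δ/(16·(2C+1)·σ), distinct indices i₁, …, i_k ∈ {1,…,t}, and pairwise disjoint sets M̃₁, …, M̃_k such that M̃_l ⊆ M_{i_l} and |M̃_l| ≥ Δ/(4·(2C+1)) for every l ∈ {1,…,k}. -/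
open Finset

set_option maxHeartbeats 4000000 in
theorem stmt_17 {α : Type*} [DecidableEq α] (Δ C : ℝ) (hΔ : 0 < Δ) (hC : 1 < C)
    (t : ℕ) (ht : 1 ≤ t) (M : Fin t → Finset α)
    (hlow : ∀ j, Δ ≤ ((M j).card : ℝ)) (hhigh : ∀ j, ((M j).card : ℝ) ≤ C * Δ)
    (hσ : (∑ i, ∑ j, ((M i ∩ M j).card : ℝ)) ≤ ((10 : ℝ) ^ 4)⁻¹ * (t : ℝ) ^ 2 * Δ) :
    ∃ (k : ℕ) (idx : Fin k → Fin t) (Mt : Fin k → Finset α),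
      (t : ℝ) ^ 2 * Δ / (16 * (2 * C + 1) * (∑ i, ∑ j, ((M i ∩ M j).card : ℝ))) ≤ (k : ℝ) ∧
      Function.Injective idx ∧
      (∀ l, Mt l ⊆ M (idx l)) ∧
      (∀ l, Δ / (4 * (2 * C + 1)) ≤ ((Mt l).card : ℝ)) ∧
      (∀ l l', l ≠ l' → Disjoint (Mt l) (Mt l')) := by
  set σ : ℝ := ∑ i, ∑ j, ((M i ∩ M j).card : ℝ) with hσdef
  have ht0 : (0 : ℝ) < t := by exact_mod_cast ht
  have hσpos : 0 < σ := by
    have h1 : ∀ i : Fin t, Δ ≤ ∑ j, ((M i ∩ M j).card : ℝ) := by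
      intro i
      refine (hlow i).trans ?_
      have := Finset.single_le_sum (f := fun j => ((M i ∩ M j).card : ℝ))
        (fun j _ => by positivity) (Finset.mem_univ i)
      simpa using this
    have h2 : ∑ _i : Fin t, Δ ≤ σ := Finset.sum_le_sum fun i _ => h1 i
    simp at h2
    nlinarith [mul_pos ht0 hΔ]
  clear_value σ
  set B : ℝ := (t : ℝ) ^ 2 * Δ / (16 * (2 * C + 1) * σ) with hB
  have hBle : B ≤ (t : ℝ) ^ 2 * Δ / (8 * σ) := by
    apply div_le_div_of_nonneg_left (by positivity) (by positivity)
    nlinarith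
  have hc : Δ / (4 * (2 * C + 1)) ≤ Δ / 2 := by
    apply div_le_div_of_nonneg_left hΔ.le (by norm_num); linarith
  clear_value B
  by_contra hcon
  -- greedy construction
  have key : ∀ n : ℕ, ∃ (S : Finset (Fin t)) (N : Fin t → Finset α), S.card = n ∧
      (∀ i ∈ S, ∑ j, ((M i ∩ M j).card : ℝ) ≤ 2 * σ / t) ∧
      (∀ i ∈ S, N i ⊆ M i) ∧
      (∀ i ∈ S, Δ / (4 * (2 * C + 1)) ≤ ((N i).card : ℝ)) ∧
      (∀ i ∈ S, ∀ j ∈ S, i ≠ j → Disjoint (N i) (N j)) := by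
    intro n
    induction n with
    | zero => exact ⟨∅, fun _ => ∅, by simp⟩
    | succ n ih =>
      obtain ⟨S, N, hS, hd, hsub, hcard, hdis⟩ := ih
      have hnB : (n : ℝ) < B := by
        by_contra hn
        push Not at hn
        let e := (S.equivFinOfCardEq hS).symm
        refine hcon ⟨n, fun l => (e l : Fin t), fun l => N (e l), hn, ?_, ?_, ?_, ?_⟩
        · exact Subtype.val_injective.comp e.injective
        · exact fun l => hsub _ (e l).2
        · exact fun l => hcard _ (e l).2
        · intro l l' hl
          exact hdis _ (e l).2 _ (e l').2 fun h => hl (e.injective (Subtype.ext h))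
      have hU : ∀ j, ((M j ∩ S.biUnion M).card : ℝ) ≤ ∑ i ∈ S, ((M i ∩ M j).card : ℝ) := by
        intro j
        have h : M j ∩ S.biUnion M ⊆ S.biUnion fun i => M i ∩ M j := by
          intro x; simp; tauto
        exact_mod_cast (Finset.card_le_card h).trans Finset.card_biUnion_le
      obtain ⟨j, hj1, hj2⟩ : ∃ j, ∑ i, ((M j ∩ M i).card : ℝ) ≤ 2 * σ / t ∧
          ((M j ∩ S.biUnion M).card : ℝ) ≤ Δ / 2 := by
        by_contra hno
        push Not at hno
        have h1 : ∀ j, (1 : ℝ) ≤ (t / (2 * σ)) * ∑ i, ((M j ∩ M i).card : ℝ) +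
            (2 / Δ) * ∑ i ∈ S, ((M i ∩ M j).card : ℝ) := by
          intro j
          by_cases hj : ∑ i, ((M j ∩ M i).card : ℝ) ≤ 2 * σ / t
          · have h3 := (hno j hj).le.trans (hU j)
            have h4 : (2 / Δ) * (Δ / 2) ≤ (2 / Δ) * ∑ i ∈ S, ((M i ∩ M j).card : ℝ) := by
              gcongr
            have h5 : (2 / Δ) * (Δ / 2) = 1 := by field_simp
            have h6 : 0 ≤ (t / (2 * σ)) * ∑ i, ((M j ∩ M i).card : ℝ) :=
              mul_nonneg (by positivity) (Finset.sum_nonneg fun _ _ => Nat.cast_nonneg _)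
            linarith
          · push Not at hj
            have h4 : (t / (2 * σ)) * (2 * σ / t) ≤
                (t / (2 * σ)) * ∑ i, ((M j ∩ M i).card : ℝ) := by
              gcongr
            have h5 : (t / (2 * σ)) * (2 * σ / t) = 1 := by field_simp
            have h6 : 0 ≤ (2 / Δ) * ∑ i ∈ S, ((M i ∩ M j).card : ℝ) :=
              mul_nonneg (by positivity) (Finset.sum_nonneg fun _ _ => Nat.cast_nonneg _)
            linarith
        have h2 := Finset.sum_le_sum fun j (_ : j ∈ (Finset.univ : Finset (Fin t))) => h1 j
        rw [Finset.sum_add_distrib, ← Finset.mul_sum, ← Finset.mul_sum, ← hσdef,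
          Finset.sum_comm] at h2
        have h3 : ∑ i ∈ S, ∑ j, ((M i ∩ M j).card : ℝ) ≤ n * (2 * σ / t) := by
          have := Finset.sum_le_sum hd
          simpa [hS] using this
        have h4 : (2 / Δ) * ∑ i ∈ S, ∑ j, ((M i ∩ M j).card : ℝ) ≤
            (2 / Δ) * (n * (2 * σ / t)) := by gcongr
        have h5 : (2 / Δ) * (n * (2 * σ / t)) < (2 / Δ) * (((t : ℝ) ^ 2 * Δ / (8 * σ)) *
            (2 * σ / t)) := by
          have := hnB.trans_le hBle
          gcongr
        have h6 : (2 / Δ) * (((t : ℝ) ^ 2 * Δ / (8 * σ)) * (2 * σ / t)) = t / 2 := by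
          field_simp; norm_num
        have h7 : (t / (2 * σ)) * σ = t / 2 := by field_simp
        simp only [Finset.sum_const, Finset.card_univ, Fintype.card_fin, nsmul_eq_mul,
          mul_one] at h2
        linarith
      have hjS : j ∉ S := by
        intro h
        rw [Finset.inter_eq_left.2 (Finset.subset_biUnion_of_mem M h)] at hj2
        linarith [hlow j]
      have hne : ∀ i ∈ S, i ≠ j := fun i hi h => hjS (h ▸ hi)
      have hnew : ∀ i ∈ S, Disjoint (M j \ S.biUnion M) (N i) := fun i hi =>
        Finset.disjoint_of_subset_right
          ((hsub i hi).trans (Finset.subset_biUnion_of_mem M hi)) Finset.sdiff_disjoint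
      refine ⟨insert j S, Function.update N j (M j \ S.biUnion M), ?_, ?_, ?_, ?_, ?_⟩
      · rw [Finset.card_insert_of_notMem hjS, hS]
      · intro i hi
        rcases Finset.mem_insert.1 hi with rfl | hi
        · exact hj1
        · exact hd i hi
      · intro i hi
        rcases Finset.mem_insert.1 hi with rfl | hi
        · simp
        · rw [Function.update_of_ne (hne i hi)]; exact hsub i hi
      · intro i hi
        rcases Finset.mem_insert.1 hi with rfl | hi
        · rw [Function.update_self]
          have h : ((M i \ S.biUnion M).card : ℝ) + ((M i ∩ S.biUnion M).card : ℝ)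
              = (M i).card := by exact_mod_cast Finset.card_sdiff_add_card_inter _ _
          linarith [hlow i]
        · rw [Function.update_of_ne (hne i hi)]; exact hcard i hi
      · intro i hi0 i' hi0' hii
        rcases Finset.mem_insert.1 hi0 with rfl | hi
        · rcases Finset.mem_insert.1 hi0' with rfl | hi'
          · exact absurd rfl hii
          · rw [Function.update_self, Function.update_of_ne (hne i' hi')]
            exact hnew i' hi'
        · rcases Finset.mem_insert.1 hi0' with rfl | hi'
          · rw [Function.update_self, Function.update_of_ne (hne i hi)]
            exact (hnew i hi).symm
          · rw [Function.update_of_ne (hne i hi), Function.update_of_ne (hne i' hi')]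
            exact hdis i hi i' hi' hii
  obtain ⟨S, N, hS, -⟩ := key (t + 1)
  have := Finset.card_le_univ S
  simp [hS] at this
end
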